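/- Let Ω ⊆ ℝ² be open and Ψ = (P, Q) : Ω → ℝ² be a C¹ jacobian map, i.e. δ(z) = P_x(z)Q_y(z) − P_y(z)Q_x(z) ≠ 0 for all z ∈ Ω. Define the vector fields V_δ = ((P·P_y + Q·Q_y)/δ, −(P·P_x + Q·Q_x)/δ) and W_δ = ((P·Q_y − Q·P_y)/δ, (−P·Q_x + Q·P_x)/δ) on Ω. Then for every z ∈ Ω, DΨ(z)(V_δ(z)) = (Q(z), −P(z)) and DΨ(z)(W_δ(z)) = (P(z), Q(z)); i.e. Ψ transforms the system z' = V_δ(z) into the linear center u' = v, v' = −u, and the system z' = W_δ(z) into the radial system u' = u, v' = v. -/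

import Mathlib

/-- Partial derivative with respect to `x`. -/
noncomputable def pdx (f : ℝ × ℝ → ℝ) (z : ℝ × ℝ) : ℝ := fderiv ℝ f z (1, 0)

/-- Partial derivative with respect to `y`. -/
noncomputable def pdy (f : ℝ × ℝ → ℝ) (z : ℝ × ℝ) : ℝ := fderiv ℝ f z (0, 1)

/-- The derivative of `f` in the direction `v` in terms of its partial derivatives. -/
theorem fderiv_apply_eq_pdx_pdy (f : ℝ × ℝ → ℝ) (z v : ℝ × ℝ) :
    fderiv ℝ f z v = v.1 * pdx f z + v.2 * pdy f z := by
  have hv : v = v.1 • ((1, 0) : ℝ × ℝ) + v.2 • ((0, 1) : ℝ × ℝ) := by ext <;> simp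
  conv_lhs => rw [hv]
  simp only [map_add, map_smul, smul_eq_mul, pdx, pdy]

/-- a jacobian map `Ψ = (P, Q)` transforms the system
`z' = V_δ(z)` into the linear center `u' = v, v' = −u`, and the system
`z' = W_δ(z)` into the radial system `u' = u, v' = v`. -/
theorem jacobian_map_linearizes
    (Ω : Set (ℝ × ℝ)) (hΩ : IsOpen Ω)
    (P Q : ℝ × ℝ → ℝ)
    (hP : ContDiffOn ℝ 1 P Ω) (hQ : ContDiffOn ℝ 1 Q Ω)
    (Ψ : ℝ × ℝ → ℝ × ℝ) (hΨ : ∀ z, Ψ z = (P z, Q z))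
    (δ : ℝ × ℝ → ℝ)
    (hδ : ∀ z, δ z = pdx P z * pdy Q z - pdy P z * pdx Q z)
    (hδne : ∀ z ∈ Ω, δ z ≠ 0)
    (Vδ Wδ : ℝ × ℝ → ℝ × ℝ)
    (hVδ : ∀ z, Vδ z = ((P z * pdy P z + Q z * pdy Q z) / δ z,
                        -(P z * pdx P z + Q z * pdx Q z) / δ z))
    (hWδ : ∀ z, Wδ z = ((P z * pdy Q z - Q z * pdy P z) / δ z,
                        (-(P z * pdx Q z) + Q z * pdx P z) / δ z)) :
    ∀ z ∈ Ω,
      fderiv ℝ Ψ z (Vδ z) = (Q z, -P z)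
      ∧ fderiv ℝ Ψ z (Wδ z) = (P z, Q z) := by
  intro z hz
  have hdP : DifferentiableAt ℝ P z :=
    (hP.contDiffAt (hΩ.mem_nhds hz)).differentiableAt one_ne_zero
  have hdQ : DifferentiableAt ℝ Q z :=
    (hQ.contDiffAt (hΩ.mem_nhds hz)).differentiableAt one_ne_zero
  have hne := hδne z hz
  have hδz := hδ z
  have hD (v : ℝ × ℝ) : fderiv ℝ Ψ z v =
      (v.1 * pdx P z + v.2 * pdy P z, v.1 * pdx Q z + v.2 * pdy Q z) := by
    rw [funext hΨ, hdP.fderiv_prodMk hdQ, ContinuousLinearMap.prod_apply,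
      fderiv_apply_eq_pdx_pdy, fderiv_apply_eq_pdx_pdy]
  rw [hD, hD, hVδ, hWδ]
  refine ⟨Prod.ext ?_ ?_, Prod.ext ?_ ?_⟩ <;> dsimp only <;> field_simp <;> rw [hδz] <;> ring
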